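/- Let φ : ℝ^d → ℝ be differentiable convex with conjugate φ*, f continuously differentiable, λ > 0, and suppose φ* is differentiable at λx_t along the trajectory. Consider the Frank–Wolfe-type ODE ẋ_t = ∇φ(−∇f(x_t)) − λ x_t. Then the objective F(x) = f(x) + (1/λ) φ*(λx) decreases monotonically along solutions: (d/dt) F(x_t) = (∇f(x_t) + ∇φ*(λ x_t))ᵀ(∇φ(−∇f(x_t)) − λ x_t) ≤ 0. -/

import Mathlib

open scoped RealInnerProductSpace

/-- The convex (Fenchel) conjugate `φ*(y) = sup_z (yᵀz − φ(z))`,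
valued in the extended reals. -/
noncomputable def fenchelConj {d : ℕ} (φ : EuclideanSpace ℝ (Fin d) → ℝ)
    (y : EuclideanSpace ℝ (Fin d)) : EReal :=
  ⨆ z : EuclideanSpace ℝ (Fin d), ((⟪y, z⟫ - φ z : ℝ) : EReal)

/-- `v` is a subgradient of the conjugate `φ*` at `y`. -/
def IsConjSubgrad {d : ℕ} (φ : EuclideanSpace ℝ (Fin d) → ℝ)
    (v y : EuclideanSpace ℝ (Fin d)) : Prop :=
  ∀ w, fenchelConj φ y + ((⟪v, w - y⟫ : ℝ) : EReal) ≤ fenchelConj φ w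

/-- A convex function lies above its tangent hyperplanes. -/
theorem ConvexOn.add_inner_gradient_le {E : Type*} [NormedAddCommGroup E]
    [InnerProductSpace ℝ E] [CompleteSpace E] {φ : E → ℝ} {p g : E}
    (hconv : ConvexOn ℝ Set.univ φ) (hg : HasGradientAt φ g p) (z : E) :
    φ p + ⟪g, z - p⟫ ≤ φ z := by
  have hline : HasDerivAt (AffineMap.lineMap p z : ℝ → E) (z - p) 0 :=
    AffineMap.hasDerivAt_lineMap
  have hderiv : HasDerivAt (φ ∘ (AffineMap.lineMap p z : ℝ → E)) ⟪g, z - p⟫ 0 := by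
    have hp : HasGradientAt φ g (AffineMap.lineMap p z (0 : ℝ)) := by simpa using hg
    simpa using hp.hasFDerivAt.comp_hasDerivAt 0 hline
  have hc : ConvexOn ℝ Set.univ (φ ∘ (AffineMap.lineMap p z : ℝ → E)) := by
    simpa using hconv.comp_affineMap (AffineMap.lineMap p z)
  have := hc.le_slope_of_hasDerivAt (Set.mem_univ 0) (Set.mem_univ 1) one_pos hderiv
  simp [slope_def_field] at this
  linarith

/-- At a gradient of a convex function the conjugate attains equality in Fenchel-Young
(only the nontrivial inequality is recorded). -/
theorem fenchelConj_gradient_le {d : ℕ} {φ : EuclideanSpace ℝ (Fin d) → ℝ}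
    {p g : EuclideanSpace ℝ (Fin d)} (hconv : ConvexOn ℝ Set.univ φ)
    (hg : HasGradientAt φ g p) :
    fenchelConj φ g ≤ ((⟪g, p⟫ - φ p : ℝ) : EReal) := by
  refine iSup_le fun z => EReal.coe_le_coe_iff.2 ?_
  have h := hconv.add_inner_gradient_le hg z
  rw [inner_sub_right] at h
  linarith

/-- The subgradients of a convex function and of its conjugate satisfy
`0 ≤ ⟪p - s, ∇φ p - y⟫` for every subgradient `s` of the conjugate at `y`. -/
theorem IsConjSubgrad.inner_sub_nonneg {d : ℕ} {φ : EuclideanSpace ℝ (Fin d) → ℝ}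
    {p g s y : EuclideanSpace ℝ (Fin d)} (hs : IsConjSubgrad φ s y)
    (hconv : ConvexOn ℝ Set.univ φ) (hg : HasGradientAt φ g p) :
    0 ≤ ⟪p - s, g - y⟫ := by
  have hy : ((⟪y, p⟫ - φ p : ℝ) : EReal) ≤ fenchelConj φ y :=
    le_iSup (fun z => ((⟪y, z⟫ - φ z : ℝ) : EReal)) p
  have h := (add_le_add_left hy ((⟪s, g - y⟫ : ℝ) : EReal)).trans
    ((hs g).trans (fenchelConj_gradient_le hconv hg))
  rw [← EReal.coe_add, EReal.coe_le_coe_iff] at h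
  rw [inner_sub_left, inner_sub_right p, real_inner_comm g p, real_inner_comm y p]
  linarith

/-- Frank–Wolfe-type ODE: for `ẋ = ∇φ(−∇f(x)) − λx` with `λ > 0`,
`φ` differentiable convex and `φ*` finite (with real value `φs`) and differentiable
(with gradient `φs'`) at `λ x_t` along the trajectory, the objective
`F(x) = f(x) + (1/λ) φ*(λx)` decreases monotonically:
`(d/dt) F(x_t) = (∇f(x_t) + ∇φ*(λx_t))ᵀ(∇φ(−∇f(x_t)) − λx_t) ≤ 0`. -/
theorem lion_frank_wolfe_descent {d : ℕ}
    (φ f : EuclideanSpace ℝ (Fin d) → ℝ)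
    (φ' f' : EuclideanSpace ℝ (Fin d) → EuclideanSpace ℝ (Fin d))
    (φs : EuclideanSpace ℝ (Fin d) → ℝ)
    (φs' : EuclideanSpace ℝ (Fin d) → EuclideanSpace ℝ (Fin d))
    (hconv : ConvexOn ℝ Set.univ φ)
    (hφ' : ∀ z, HasGradientAt φ (φ' z) z)
    (hf' : ∀ z, HasGradientAt f (f' z) z) (hf'c : Continuous f')
    (lam : ℝ) (hlam : 0 < lam)
    (x : ℝ → EuclideanSpace ℝ (Fin d))
    (hx : ∀ t, HasDerivAt x (φ' (-(f' (x t))) - lam • x t) t)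
    (hfin : ∀ t : ℝ, fenchelConj φ (lam • x t) = ((φs (lam • x t) : ℝ) : EReal))
    (hφs' : ∀ t : ℝ, HasGradientAt φs (φs' (lam • x t)) (lam • x t))
    (hsub : ∀ t : ℝ, IsConjSubgrad φ (φs' (lam • x t)) (lam • x t)) :
    ∀ t : ℝ,
      HasDerivAt (fun τ => f (x τ) + (1 / lam) * φs (lam • x τ))
        ⟪f' (x t) + φs' (lam • x t), φ' (-(f' (x t))) - lam • x t⟫ t
      ∧ ⟪f' (x t) + φs' (lam • x t), φ' (-(f' (x t))) - lam • x t⟫ ≤ 0 := by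
  intro t
  constructor
  · have h₁ := (hf' (x t)).hasFDerivAt.comp_hasDerivAt t (hx t)
    have h₂ := (hφs' t).hasFDerivAt.comp_hasDerivAt t ((hx t).const_smul lam)
    refine (h₁.add (h₂.const_mul (1 / lam))).congr_deriv ?_
    rw [InnerProductSpace.toDual_apply_apply, InnerProductSpace.toDual_apply_apply,
      inner_smul_right, inner_add_left]
    field_simp
  · have h := (hsub t).inner_sub_nonneg hconv (hφ' (-(f' (x t))))
    rw [← neg_add', inner_neg_left] at h
    linarith
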